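/- Fix a positive integer ℓ_B. Then, as ℓ_A → ∞ through the positive integers, P(ℓ_A, ℓ_B) − (1/(π ℓ_A)) · [2ℓ_B + (2/3)·ℓ_B(1 − ℓ_B²)/ℓ_A²] = O(ℓ_A^{−5}). -/

import Mathlib

open MeasureTheory Real Filter Asymptotics

/-- Modified Bessel function of the first kind, integer order, defined by its series. -/
noncomputable def besselI (n : ℕ) (x : ℝ) : ℝ :=
  ∑' m : ℕ, (x / 2) ^ (n + 2 * m) / ((m.factorial : ℝ) * ((n + m).factorial : ℝ))

/-- Probability that walker `A` first reaches site `a` before walker `B` first reaches `b`. -/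
noncomputable def Pfirst (a b : ℕ) : ℝ :=
  (a : ℝ) * (b : ℝ) * ∫ tA in Set.Ioi (0 : ℝ),
    (Real.exp (-tA) * besselI a tA / tA) *
      ∫ tB in Set.Ioi tA, Real.exp (-tB) * besselI b tB / tB

/-! ### Integral representation of the Bessel function -/

theorem integral_cos_int_mul (m : ℤ) :
    ∫ θ in (0 : ℝ)..π, cos (m * θ) = if m = 0 then π else 0 := by
  split_ifs with h
  · simp [h]
  · have hm : (m : ℝ) ≠ 0 := by exact_mod_cast h
    rw [intervalIntegral.integral_comp_mul_left (fun x => cos x) hm]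
    simp [integral_cos, sin_int_mul_pi]

theorem hasSum_exp_mul_cos_mul_cos (t θ : ℝ) (n : ℕ) :
    HasSum (fun p : ℕ × ℕ => (t / 2) ^ (p.1 + p.2) / ((p.1.factorial : ℝ) * p.2.factorial) *
      cos (((p.1 - p.2 - n : ℤ) : ℝ) * θ)) (exp (t * cos θ) * cos (n * θ)) := by
  have key : ∀ z : ℂ, HasSum (fun k : ℕ => z ^ k / (k.factorial : ℂ)) (Complex.exp z) := fun z => by
    rw [Complex.exp_eq_exp_ℂ]
    exact NormedSpace.expSeries_div_hasSum_exp z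
  have hn : ∀ z : ℂ, Summable fun k : ℕ => ‖z ^ k / (k.factorial : ℂ)‖ := fun z =>
    NormedSpace.norm_expSeries_div_summable z
  obtain ⟨z, hz⟩ : ∃ z : ℂ, z = (t / 2 : ℝ) * Complex.exp (θ * Complex.I) := ⟨_, rfl⟩
  obtain ⟨w, hw⟩ : ∃ w : ℂ, w = (t / 2 : ℝ) * Complex.exp (-θ * Complex.I) := ⟨_, rfl⟩
  have hterm : ∀ p : ℕ × ℕ, z ^ p.1 / (p.1.factorial : ℂ) * (w ^ p.2 / (p.2.factorial : ℂ)) *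
      Complex.exp (-(n * θ) * Complex.I) =
      (((t / 2) ^ (p.1 + p.2) / ((p.1.factorial : ℝ) * p.2.factorial) : ℝ) : ℂ) *
      Complex.exp (((((p.1 - p.2 - n : ℤ) : ℝ) * θ : ℝ) : ℂ) * Complex.I) := fun p => by
    have : Complex.exp (((((p.1 - p.2 - n : ℤ) : ℝ) * θ : ℝ) : ℂ) * Complex.I) =
        Complex.exp (p.1 * (θ * Complex.I)) * Complex.exp (p.2 * (-θ * Complex.I)) *
        Complex.exp (-(n * θ) * Complex.I) := by
      rw [← Complex.exp_add, ← Complex.exp_add]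
      congr 1
      push_cast
      ring
    rw [this, hz, hw, mul_pow, mul_pow, ← Complex.exp_nat_mul, ← Complex.exp_nat_mul]
    push_cast
    rw [pow_add]
    field_simp
  have hval : Complex.exp z * Complex.exp w * Complex.exp (-(n * θ) * Complex.I) =
      ((exp (t * cos θ) : ℝ) : ℂ) * Complex.exp (((-(n * θ) : ℝ) : ℂ) * Complex.I) := by
    have hzw : z + w = ((t * cos θ : ℝ) : ℂ) := by
      have := Complex.two_cos (θ : ℂ)
      rw [hz, hw]
      push_cast
      linear_combination (-(t : ℂ) / 2) * this
    rw [← Complex.exp_add, hzw, Complex.ofReal_exp]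
    push_cast
    rfl
  have hmul : ∀ (f g : ℕ → ℂ) (a b : ℂ), HasSum f a → HasSum g b → (Summable fun k => ‖f k‖) →
      (Summable fun k => ‖g k‖) → HasSum (fun p : ℕ × ℕ => f p.1 * g p.2) (a * b) :=
    fun f g a b hf hg hf' hg' => hf.mul hg (summable_mul_of_summable_norm hf' hg')
  have h1 := (hmul _ _ _ _ (key z) (key w) (hn z) (hn w)).mul_right
    (Complex.exp (-(n * θ) * Complex.I))
  rw [hval] at h1
  rw [funext hterm] at h1
  have h2 := Complex.hasSum_re h1
  simpa only [Complex.re_ofReal_mul, Complex.exp_ofReal_mul_I_re, cos_neg] using h2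

theorem besselI_eq_integral (n : ℕ) (t : ℝ) :
    π * besselI n t = ∫ θ in (0 : ℝ)..π, exp (t * cos θ) * cos (n * θ) := by
  have hs : Summable fun p : ℕ × ℕ =>
      |(t / 2) ^ (p.1 + p.2) / ((p.1.factorial : ℝ) * p.2.factorial)| := by
    have h : ∀ k : ℝ, Summable fun j : ℕ => ‖k ^ j / (j.factorial : ℝ)‖ := fun k =>
      NormedSpace.norm_expSeries_div_summable k
    have := (summable_mul_of_summable_norm (h (t / 2)) (h (t / 2))).norm
    refine this.congr fun p => ?_
    rw [Real.norm_eq_abs, pow_add]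
    congr 1
    field_simp
  have h := intervalIntegral.hasSum_integral_of_dominated_convergence (μ := volume)
    (a := (0 : ℝ)) (b := π)
    (F := fun (p : ℕ × ℕ) θ => (t / 2) ^ (p.1 + p.2) / ((p.1.factorial : ℝ) * p.2.factorial) *
      cos (((p.1 - p.2 - n : ℤ) : ℝ) * θ)) (f := fun θ => exp (t * cos θ) * cos (n * θ))
    (fun p _ => |(t / 2) ^ (p.1 + p.2) / ((p.1.factorial : ℝ) * p.2.factorial)|)
    (fun p => by fun_prop)
    (fun p => ae_of_all _ fun θ _ => by
      rw [norm_mul, Real.norm_eq_abs, Real.norm_eq_abs]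
      exact mul_le_of_le_one_right (abs_nonneg _) (abs_cos_le_one _))
    (ae_of_all _ fun _ _ => hs) (by simp)
    (ae_of_all _ fun θ _ => hasSum_exp_mul_cos_mul_cos t θ n)
  simp only [intervalIntegral.integral_const_mul, integral_cos_int_mul] at h
  have hinj : Function.Injective fun m : ℕ => (n + m, m) := fun a b hab => (Prod.ext_iff.1 hab).2
  rw [← hinj.hasSum_iff] at h
  · rw [← h.tsum_eq, besselI, ← tsum_mul_left]
    refine tsum_congr fun m => ?_
    have h0 : ((n + m : ℕ) : ℤ) - m - n = 0 := by push_cast; ring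
    simp only [Function.comp, h0, if_true]
    rw [show n + m + m = n + 2 * m by ring]
    ring
  · rintro ⟨j, k⟩ hjk
    rw [if_neg, mul_zero]
    intro h0
    exact hjk ⟨k, by simp only [Prod.mk.injEq, and_true]; omega⟩

theorem natCast_mul_besselI_eq_integral (n : ℕ) (t : ℝ) :
    π * (n * besselI n t) = t * ∫ θ in (0 : ℝ)..π, exp (t * cos θ) * (sin θ * sin (n * θ)) := by
  have h := intervalIntegral.integral_mul_deriv_eq_deriv_mul (a := (0 : ℝ)) (b := π)
    (u := fun θ => exp (t * cos θ)) (u' := fun θ => exp (t * cos θ) * (t * -sin θ))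
    (v := fun θ => sin (n * θ)) (v' := fun θ => cos (n * θ) * (n * 1))
    (fun θ _ => ((hasDerivAt_cos θ).const_mul t).exp)
    (fun θ _ => ((hasDerivAt_id θ).const_mul (n : ℝ)).sin)
    (by apply Continuous.intervalIntegrable; fun_prop)
    (by apply Continuous.intervalIntegrable; fun_prop)
  simp only [sin_nat_mul_pi, mul_zero, sin_zero, sub_zero, zero_sub] at h
  have h1 : π * (n * besselI n t) = n * (π * besselI n t) := by ring
  rw [h1, besselI_eq_integral, ← intervalIntegral.integral_const_mul,
    ← intervalIntegral.integral_const_mul]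
  rw [← intervalIntegral.integral_neg] at h
  calc _ = ∫ θ in (0 : ℝ)..π, exp (t * cos θ) * (cos (n * θ) * (n * 1)) := by
        congr 1; funext θ; ring
    _ = _ := h
    _ = _ := by congr 1; funext θ; ring

/-! ### The hitting time density and its Laplace transform -/

theorem abs_sin_nat_mul_le (n : ℕ) (θ : ℝ) : |sin (n * θ)| ≤ n * |sin θ| := by
  induction n with
  | zero => simp
  | succ n ih =>
    have h : sin ((n + 1 : ℕ) * θ) = sin (n * θ) * cos θ + cos (n * θ) * sin θ := by
      rw [← sin_add]
      push_cast
      ring_nf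
    rw [h]
    calc _ ≤ |sin (n * θ)| * |cos θ| + |cos (n * θ)| * |sin θ| := by
          rw [← abs_mul, ← abs_mul]
          exact abs_add_le _ _
      _ ≤ |sin (n * θ)| * 1 + 1 * |sin θ| := by
          gcongr <;> exact abs_cos_le_one _
      _ ≤ _ := by
          push_cast
          linarith

theorem cos_lt_one_of_mem_Ioc {θ : ℝ} (h : θ ∈ Set.Ioc 0 π) : cos θ < 1 := by
  have := cos_lt_cos_of_nonneg_of_le_pi le_rfl h.2 h.1
  rwa [cos_zero] at this

theorem abs_sin_mul_sin_div_le (n : ℕ) {s θ : ℝ} (hs : 0 ≤ s) (hθ : θ ∈ Set.Ioc 0 π) :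
    |sin θ * sin (n * θ) / (1 + s - cos θ)| ≤ 2 * n := by
  have hc := cos_lt_one_of_mem_Ioc hθ
  have hpos : 0 < 1 + s - cos θ := by linarith
  rw [abs_div, abs_of_pos hpos, div_le_iff₀ hpos, abs_mul]
  calc _ ≤ |sin θ| * (n * |sin θ|) := by gcongr; exact abs_sin_nat_mul_le n θ
    _ = n * sin θ ^ 2 := by rw [← sq_abs (sin θ)]; ring
    _ = n * ((1 + cos θ) * (1 - cos θ)) := by rw [sin_sq]; ring
    _ ≤ n * (2 * (1 + s - cos θ)) := by
        gcongr ?_ * ?_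
        apply mul_le_mul <;> linarith [cos_le_one θ]
    _ = _ := by ring

theorem integrable_sin_mul_sin_div (n : ℕ) {s : ℝ} (hs : 0 ≤ s) :
    Integrable (fun θ => sin θ * sin (n * θ) / (1 + s - cos θ))
      (volume.restrict (Set.Ioc 0 π)) := by
  refine Integrable.of_bound (C := 2 * n) ?_ ?_
  · exact Measurable.aestronglyMeasurable (by fun_prop)
  · filter_upwards [ae_restrict_mem measurableSet_Ioc] with θ hθ
    exact abs_sin_mul_sin_div_le n hs hθ

theorem integral_exp_neg_mul_Ioi' {c : ℝ} (hc : 0 < c) (T : ℝ) :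
    ∫ t in Set.Ioi T, exp (-(t * c)) = exp (-(T * c)) / c := by
  have := integral_exp_mul_Ioi (neg_neg_of_pos hc) T
  simp only [neg_mul, mul_comm c, neg_div_neg_eq] at this
  exact this

theorem integrable_exp_mul_sin_mul_sin (n : ℕ) {s : ℝ} (hs : 0 ≤ s) :
    Integrable (Function.uncurry fun t θ : ℝ => exp (-(t * (1 + s - cos θ))) *
      (sin θ * sin (n * θ)))
      ((volume.restrict (Set.Ioi 0)).prod (volume.restrict (Set.Ioc 0 π))) := by
  rw [integrable_prod_iff' (Continuous.aestronglyMeasurable (by fun_prop))]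
  constructor
  · filter_upwards [ae_restrict_mem measurableSet_Ioc] with θ hθ
    have hpos : 0 < 1 + s - cos θ := by linarith [cos_lt_one_of_mem_Ioc hθ]
    have := integrableOn_exp_mul_Ioi (neg_neg_of_pos hpos) 0
    simp only [neg_mul, mul_comm (1 + s - cos θ)] at this
    exact Integrable.mul_const this (sin θ * sin (n * θ))
  · refine (integrable_sin_mul_sin_div n hs).norm.congr ?_
    filter_upwards [ae_restrict_mem measurableSet_Ioc] with θ hθ
    have hpos : 0 < 1 + s - cos θ := by linarith [cos_lt_one_of_mem_Ioc hθ]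
    simp only [Function.uncurry, norm_mul, norm_div, Real.norm_eq_abs, abs_exp]
    rw [integral_mul_const, integral_exp_neg_mul_Ioi' hpos, abs_of_pos hpos]
    simp
    ring

theorem exp_mul_besselI_div_eq_integral (n : ℕ) (s : ℝ) {t : ℝ} (ht : 0 < t) :
    π * (exp (-(t * s)) * (n * (exp (-t) * besselI n t / t))) =
      ∫ θ in Set.Ioc 0 π, exp (-(t * (1 + s - cos θ))) * (sin θ * sin (n * θ)) := by
  have h := natCast_mul_besselI_eq_integral n t
  rw [intervalIntegral.integral_of_le pi_pos.le] at h
  calc π * (exp (-(t * s)) * (n * (exp (-t) * besselI n t / t)))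
      = exp (-(t * s)) * exp (-t) / t * (π * (n * besselI n t)) := by ring
    _ = exp (-(t * s)) * exp (-t) *
        ∫ θ in Set.Ioc 0 π, exp (t * cos θ) * (sin θ * sin (n * θ)) := by
        rw [h]
        field_simp
    _ = _ := by
        rw [← integral_const_mul]
        congr 1
        funext θ
        rw [← mul_assoc, ← exp_add, ← exp_add]
        ring_nf

theorem integrableOn_besselI_density (n : ℕ) :
    IntegrableOn (fun t => n * (exp (-t) * besselI n t / t)) (Set.Ioi 0) := by
  have h := (integrable_exp_mul_sin_mul_sin n le_rfl).integral_prod_left.const_mul π⁻¹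
  refine h.congr ?_
  filter_upwards [ae_restrict_mem measurableSet_Ioi] with t ht
  have := exp_mul_besselI_div_eq_integral n 0 ht
  simp only [Function.uncurry]
  rw [← this, mul_zero, neg_zero, exp_zero, one_mul, inv_mul_cancel_left₀ pi_ne_zero]

theorem integral_Ioi_exp_mul_besselI_density (n : ℕ) {s T : ℝ} (hs : 0 ≤ s) (hT : 0 ≤ T) :
    π * ∫ t in Set.Ioi T, exp (-(t * s)) * (n * (exp (-t) * besselI n t / t)) =
      ∫ θ in Set.Ioc 0 π, exp (-(T * (1 + s - cos θ))) *
        (sin θ * sin (n * θ) / (1 + s - cos θ)) := by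
  have hle : (volume.restrict (Set.Ioi T)).prod (volume.restrict (Set.Ioc 0 π)) ≤
      (volume.restrict (Set.Ioi (0 : ℝ))).prod (volume.restrict (Set.Ioc 0 π)) :=
    Measure.prod_mono (Measure.restrict_mono (Set.Ioi_subset_Ioi hT) le_rfl) le_rfl
  have hswap := integral_integral_swap ((integrable_exp_mul_sin_mul_sin n hs).mono_measure hle)
  rw [← integral_const_mul]
  calc _ = ∫ t in Set.Ioi T, ∫ θ in Set.Ioc 0 π,
        exp (-(t * (1 + s - cos θ))) * (sin θ * sin (n * θ)) :=
        setIntegral_congr_fun measurableSet_Ioi fun t ht =>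
          exp_mul_besselI_div_eq_integral n s (hT.trans_lt ht)
    _ = _ := hswap
    _ = _ := by
        refine setIntegral_congr_fun measurableSet_Ioc fun θ hθ => ?_
        have hpos : 0 < 1 + s - cos θ := by linarith [cos_lt_one_of_mem_Ioc hθ]
        rw [integral_mul_const, integral_exp_neg_mul_Ioi' hpos]
        ring

theorem hasSum_pow_mul_sin {r : ℝ} (hr : |r| < 1) (θ : ℝ) :
    HasSum (fun k : ℕ => r ^ k * sin (k * θ)) (r * sin θ / (1 - 2 * r * cos θ + r ^ 2)) := by
  have hnorm : ‖(r : ℂ) * Complex.exp (θ * Complex.I)‖ < 1 := by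
    rwa [norm_mul, Complex.norm_exp_ofReal_mul_I, mul_one, Complex.norm_real]
  have h := Complex.hasSum_im (hasSum_geometric_of_norm_lt_one hnorm)
  have hfun : (fun k : ℕ => (((r : ℂ) * Complex.exp (θ * Complex.I)) ^ k).im) =
      fun k : ℕ => r ^ k * sin (k * θ) := by
    funext k
    have : ((r : ℂ) * Complex.exp (θ * Complex.I)) ^ k =
        ((r ^ k : ℝ) : ℂ) * Complex.exp (((k * θ : ℝ) : ℂ) * Complex.I) := by
      rw [mul_pow, ← Complex.exp_nat_mul]
      push_cast
      ring_nf
    rw [this, Complex.im_ofReal_mul, Complex.exp_ofReal_mul_I_im]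
  rw [hfun] at h
  convert! h using 1
  rw [Complex.inv_im, Complex.normSq_apply]
  simp only [Complex.sub_re, Complex.sub_im, Complex.one_re, Complex.one_im,
    Complex.im_ofReal_mul, Complex.re_ofReal_mul, Complex.exp_ofReal_mul_I_im,
    Complex.exp_ofReal_mul_I_re]
  congr 1
  · ring
  · linear_combination (-r ^ 2) * sin_sq_add_cos_sq θ

theorem integral_sin_nat_mul_sin_nat (k : ℕ) {n : ℕ} (hn : 1 ≤ n) :
    ∫ θ in (0 : ℝ)..π, sin (k * θ) * sin (n * θ) = if k = n then π / 2 else 0 := by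
  have h : ∀ θ : ℝ, sin (k * θ) * sin (n * θ) =
      (cos (((k - n : ℤ) : ℝ) * θ) - cos (((k + n : ℤ) : ℝ) * θ)) / 2 := fun θ => by
    push_cast
    rw [sub_mul, add_mul, cos_sub, cos_add]
    ring
  simp only [h]
  rw [intervalIntegral.integral_div, intervalIntegral.integral_sub
    (by apply Continuous.intervalIntegrable; fun_prop)
    (by apply Continuous.intervalIntegrable; fun_prop), integral_cos_int_mul,
    integral_cos_int_mul, if_neg (show ¬ (k + n : ℤ) = 0 by omega)]
  by_cases hk : k = n
  · simp [hk]
  · rw [if_neg (show ¬ (k - n : ℤ) = 0 by omega), if_neg hk]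
    simp

theorem integral_poissonKernel_mul_sin {r : ℝ} (h0 : 0 ≤ r) (h1 : r < 1) {n : ℕ} (hn : 1 ≤ n) :
    ∫ θ in (0 : ℝ)..π, r * sin θ / (1 - 2 * r * cos θ + r ^ 2) * sin (n * θ) =
      r ^ n * (π / 2) := by
  have hr : |r| < 1 := by rwa [abs_of_nonneg h0]
  have hsum := summable_geometric_of_lt_one h0 h1
  have h := intervalIntegral.hasSum_integral_of_dominated_convergence (μ := volume)
    (a := (0 : ℝ)) (b := π)
    (F := fun (k : ℕ) θ => r ^ k * sin (k * θ) * sin (n * θ))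
    (f := fun θ => r * sin θ / (1 - 2 * r * cos θ + r ^ 2) * sin (n * θ))
    (fun k _ => r ^ k)
    (fun k => by fun_prop)
    (fun k => ae_of_all _ fun θ _ => by
      rw [norm_mul, norm_mul, Real.norm_eq_abs, Real.norm_eq_abs, Real.norm_eq_abs,
        abs_of_nonneg (pow_nonneg h0 k), mul_assoc]
      exact mul_le_of_le_one_right (pow_nonneg h0 k)
        (mul_le_one₀ (abs_sin_le_one _) (abs_nonneg _) (abs_sin_le_one _)))
    (ae_of_all _ fun _ _ => hsum) (by simp)
    (ae_of_all _ fun θ _ => (hasSum_pow_mul_sin hr θ).mul_right _)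
  simp only [mul_assoc, intervalIntegral.integral_const_mul,
    integral_sin_nat_mul_sin_nat _ hn] at h
  simp only [mul_assoc]
  rw [h.unique (hasSum_single n fun k hk => by rw [if_neg hk, mul_zero]), if_pos rfl]

theorem integral_sin_mul_sin_div_eq_pow {r s : ℝ} (h0 : 0 < r) (h1 : r < 1)
    (hrs : r ^ 2 + 1 = 2 * r * (1 + s)) {n : ℕ} (hn : 1 ≤ n) :
    ∫ θ in Set.Ioc 0 π, sin θ * sin (n * θ) / (1 + s - cos θ) = π * r ^ n := by
  have h := integral_poissonKernel_mul_sin h0.le h1 hn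
  rw [intervalIntegral.integral_of_le pi_pos.le] at h
  have h2 : ∀ θ : ℝ, sin θ * sin (n * θ) / (1 + s - cos θ) =
      2 * (r * sin θ / (1 - 2 * r * cos θ + r ^ 2) * sin (n * θ)) := fun θ => by
    rw [show 1 - 2 * r * cos θ + r ^ 2 = (2 * r) * (1 + s - cos θ) by linear_combination hrs]
    rw [mul_comm 2 r, mul_assoc r 2, mul_div_mul_left _ _ h0.ne', ← div_div, div_right_comm]
    ring
  simp only [h2]
  rw [integral_const_mul, h]
  ring

theorem laplace_besselI_density {r s : ℝ} (h0 : 0 < r) (h1 : r < 1) (hs : 0 ≤ s)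
    (hrs : r ^ 2 + 1 = 2 * r * (1 + s)) {n : ℕ} (hn : 1 ≤ n) :
    ∫ t in Set.Ioi 0, exp (-(t * s)) * (n * (exp (-t) * besselI n t / t)) = r ^ n := by
  have h := integral_Ioi_exp_mul_besselI_density n hs le_rfl
  simp only [zero_mul, neg_zero, exp_zero, one_mul,
    integral_sin_mul_sin_div_eq_pow h0 h1 hrs hn] at h
  exact mul_left_cancel₀ pi_ne_zero h

/-! ### The hitting probability as a single integral -/

/-- The value at `1 - cos θ` of the Laplace transform of the hitting time of the site `1`. -/
noncomputable def hitFactor (θ : ℝ) : ℝ := (√(1 + sin (θ / 2) ^ 2) - sin (θ / 2)) ^ 2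

theorem continuous_hitFactor : Continuous hitFactor := by
  unfold hitFactor
  fun_prop

theorem sqrt_one_add_sq_sub_pos (x : ℝ) : 0 < √(1 + x ^ 2) - x := by
  have h : |x| < √(1 + x ^ 2) := by
    rw [← sqrt_sq_eq_abs]
    exact sqrt_lt_sqrt (sq_nonneg x) (by linarith)
  linarith [le_abs_self x]

theorem hitFactor_pos (θ : ℝ) : 0 < hitFactor θ := pow_pos (sqrt_one_add_sq_sub_pos _) 2

theorem hitFactor_sq_add_one (θ : ℝ) :
    hitFactor θ ^ 2 + 1 = 2 * hitFactor θ * (1 + 2 * sin (θ / 2) ^ 2) := by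
  have h : √(1 + sin (θ / 2) ^ 2) ^ 2 = 1 + sin (θ / 2) ^ 2 := sq_sqrt (by positivity)
  unfold hitFactor
  generalize √(1 + sin (θ / 2) ^ 2) = w at h ⊢
  generalize sin (θ / 2) = x at h ⊢
  have hw : (w - x) ^ 2 + 2 * (w - x) * x - 1 = 0 := by linear_combination h
  linear_combination ((w - x) ^ 2 - 2 * (w - x) * x - 1) * hw

theorem one_sub_cos_eq (θ : ℝ) : 1 - cos θ = 2 * sin (θ / 2) ^ 2 := by
  rw [sin_sq_eq_half_sub, show 2 * (θ / 2) = θ by ring]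
  ring

theorem hitFactor_le_exp {θ : ℝ} (h0 : 0 ≤ θ) (h1 : θ ≤ π) : hitFactor θ ≤ exp (-(θ / π)) := by
  have hx : θ / π ≤ sin (θ / 2) := by
    have := mul_le_sin (x := θ / 2) (by linarith) (by linarith)
    calc θ / π = 2 / π * (θ / 2) := by ring
      _ ≤ _ := this
  have hx0 : 0 ≤ θ / π := by positivity
  have hx1 := sin_le_one (θ / 2)
  have hpos := sqrt_one_add_sq_sub_pos (sin (θ / 2))
  unfold hitFactor
  generalize sin (θ / 2) = x at hx hx1 hpos ⊢
  have h : √(1 + x ^ 2) ^ 2 = 1 + x ^ 2 := sq_sqrt (by positivity)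
  have hs : 1 ≤ √(1 + x ^ 2) := one_le_sqrt.2 (by nlinarith)
  have hle : √(1 + x ^ 2) - x ≤ 1 - x / 2 := by
    have : √(1 + x ^ 2) ≤ 1 + x / 2 := sqrt_le_iff.2 ⟨by linarith, by nlinarith⟩
    linarith
  calc (√(1 + x ^ 2) - x) ^ 2 ≤ exp (-(x / 2)) ^ 2 := by
        refine pow_le_pow_left₀ hpos.le (hle.trans ?_) 2
        linarith [add_one_le_exp (-(x / 2))]
    _ = exp (-x) := by
        rw [← exp_nat_mul]
        congr 1
        push_cast
        ring
    _ ≤ _ := exp_le_exp.2 (by linarith)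

theorem pi_mul_Pfirst {a b : ℕ} (ha : 1 ≤ a) :
    π * Pfirst a b =
      ∫ θ in Set.Ioc 0 π, sin θ * sin (b * θ) / (1 - cos θ) * hitFactor θ ^ a := by
  have hint : Integrable (Function.uncurry fun t θ : ℝ =>
      exp (-(t * (1 - cos θ))) * ((a * (exp (-t) * besselI a t / t)) *
        (sin θ * sin (b * θ) / (1 - cos θ))))
      ((volume.restrict (Set.Ioi 0)).prod (volume.restrict (Set.Ioc 0 π))) := by
    have hb := integrable_sin_mul_sin_div b le_rfl
    rw [add_zero] at hb
    refine Integrable.bdd_mul (c := 1) ((integrableOn_besselI_density a).mul_prod hb)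
      (Continuous.aestronglyMeasurable (by fun_prop)) ?_
    have hfst : ∀ᵐ p : ℝ × ℝ ∂((volume.restrict (Set.Ioi 0)).prod (volume.restrict (Set.Ioc 0 π))),
        p.1 ∈ Set.Ioi (0 : ℝ) :=
      Measure.quasiMeasurePreserving_fst.ae (ae_restrict_mem measurableSet_Ioi)
    filter_upwards [hfst] with p hp
    rw [Real.norm_eq_abs, abs_exp, exp_le_one_iff, neg_nonpos]
    exact mul_nonneg (le_of_lt hp) (by linarith [cos_le_one p.2])
  have hswap := integral_integral_swap hint
  calc π * Pfirst a b = ∫ t in Set.Ioi (0 : ℝ), (a * (exp (-t) * besselI a t / t)) *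
        (π * ∫ u in Set.Ioi t, exp (-(u * 0)) * (b * (exp (-u) * besselI b u / u))) := by
        simp only [mul_zero, neg_zero, exp_zero, one_mul, integral_const_mul]
        rw [Pfirst, ← mul_assoc, ← integral_const_mul]
        congr 1
        funext t
        ring
    _ = ∫ t in Set.Ioi (0 : ℝ), ∫ θ in Set.Ioc 0 π, exp (-(t * (1 - cos θ))) *
        ((a * (exp (-t) * besselI a t / t)) * (sin θ * sin (b * θ) / (1 - cos θ))) := by
        refine setIntegral_congr_fun measurableSet_Ioi fun t ht => ?_
        rw [integral_Ioi_exp_mul_besselI_density b le_rfl (le_of_lt ht), ← integral_const_mul]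
        simp only [add_zero]
        congr 1
        funext θ
        ring
    _ = _ := hswap
    _ = _ := by
        refine setIntegral_congr_fun measurableSet_Ioc fun θ hθ => ?_
        have hs : 0 ≤ 1 - cos θ := by linarith [cos_le_one θ]
        have hlt : hitFactor θ < 1 := (hitFactor_le_exp hθ.1.le hθ.2).trans_lt
          (exp_lt_one_iff.2 (neg_neg_of_pos (div_pos hθ.1 pi_pos)))
        have hrs : hitFactor θ ^ 2 + 1 = 2 * hitFactor θ * (1 + (1 - cos θ)) := by
          rw [one_sub_cos_eq, hitFactor_sq_add_one]
        rw [← laplace_besselI_density (hitFactor_pos θ) hlt hs hrs ha, ← integral_const_mul]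
        congr 1
        funext t
        ring

/-! ### Asymptotics of the integral -/

theorem exists_abs_sin_nat_mul_sub_le (n : ℕ) : ∃ C : ℝ, 0 ≤ C ∧ ∀ θ : ℝ,
    |sin (n * θ) - sin θ * (n * (1 + 2 / 3 * (1 - (n : ℝ) ^ 2) * sin (θ / 2) ^ 2))| ≤
      C * (sin (θ / 2) ^ 2) ^ 2 * |sin θ| := by
  induction n using Nat.twoStepInduction with
  | zero => exact ⟨0, le_rfl, by simp⟩
  | one => exact ⟨0, le_rfl, by simp⟩
  | more n ih ih' =>
    obtain ⟨C, hC, h⟩ := ih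
    obtain ⟨D, hD, h'⟩ := ih'
    refine ⟨2 * D + C + |8 / 3 * ((n : ℝ) + 1) * (1 - ((n : ℝ) + 1) ^ 2)|, by positivity, fun θ => ?_⟩
    have hrec : sin ((n + 2 : ℕ) * θ) = 2 * cos θ * sin ((n + 1 : ℕ) * θ) - sin (n * θ) := by
      have h1 : ((n + 2 : ℕ) : ℝ) * θ = (n + 1 : ℕ) * θ + θ := by push_cast; ring
      have h2 : (n : ℝ) * θ = (n + 1 : ℕ) * θ - θ := by push_cast; ring
      rw [h1, h2, sin_add, sin_sub]
      ring
    have hcos : cos θ = 1 - 2 * sin (θ / 2) ^ 2 := by linarith [one_sub_cos_eq θ]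
    have hc := abs_cos_le_one θ
    specialize h θ
    specialize h' θ
    rw [hrec]
    generalize sin ((n + 1 : ℕ) * θ) = v at h' ⊢
    generalize sin (n * θ) = u at h ⊢
    generalize sin θ = x at h h' ⊢
    generalize sin (θ / 2) ^ 2 = y at h h' hcos ⊢
    push_cast at h' ⊢
    have hsplit : 2 * cos θ * v - u -
          x * ((n + 2) * (1 + 2 / 3 * (1 - ((n : ℝ) + 2) ^ 2) * y)) =
        2 * cos θ * (v - x * ((n + 1) * (1 + 2 / 3 * (1 - ((n : ℝ) + 1) ^ 2) * y))) -
        (u - x * (n * (1 + 2 / 3 * (1 - (n : ℝ) ^ 2) * y))) -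
        8 / 3 * (n + 1) * (1 - ((n : ℝ) + 1) ^ 2) * (y ^ 2 * x) := by
      rw [hcos]
      ring
    rw [hsplit]
    refine (abs_sub _ _).trans ((add_le_add_left (abs_sub _ _) _).trans ?_)
    rw [abs_mul (2 * cos θ), abs_mul 2, abs_mul _ (y ^ 2 * x), abs_mul (y ^ 2) x,
      abs_of_nonneg (sq_nonneg y), abs_two]
    have : 2 * |cos θ| * |v - x * ((n + 1) * (1 + 2 / 3 * (1 - ((n : ℝ) + 1) ^ 2) * y))| ≤
        2 * 1 * (D * y ^ 2 * |x|) := by gcongr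
    linarith

theorem abs_sqrt_one_sub_sub_inv_le {y : ℝ} (h0 : 0 ≤ y) (h1 : y ≤ 1) :
    |√(1 - y) - 1 / √(1 + y)| ≤ y ^ 2 := by
  have hs : 1 ≤ √(1 + y) := one_le_sqrt.2 (by linarith)
  have hpos : 0 < √(1 + y) := by linarith
  have hle : √(1 - y) * √(1 + y) ≤ 1 := by
    rw [← sqrt_mul (by linarith)]
    exact sqrt_le_one.2 (by nlinarith)
  have hge : 1 - y ^ 2 ≤ √(1 - y) * √(1 + y) := by
    rw [← sqrt_mul (by linarith)]
    have hy : 0 ≤ 1 - y ^ 2 := by nlinarith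
    exact le_sqrt_of_sq_le (by nlinarith [mul_nonneg (sq_nonneg y) hy])
  have heq : √(1 - y) - 1 / √(1 + y) = (√(1 - y) * √(1 + y) - 1) / √(1 + y) := by
    field_simp
  rw [heq, abs_div, abs_of_pos hpos, div_le_iff₀ hpos, abs_of_nonpos (by linarith)]
  nlinarith [sq_nonneg y]

theorem exists_abs_sin_mul_sin_div_sub_le (n : ℕ) : ∃ C : ℝ, 0 ≤ C ∧ ∀ θ ∈ Set.Ioc 0 π,
    |sin θ * sin (n * θ) / (1 - cos θ) -
      2 * n * ((1 + 2 / 3 * (1 - (n : ℝ) ^ 2) * sin (θ / 2) ^ 2) *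
        (cos (θ / 2) / √(1 + sin (θ / 2) ^ 2)))| ≤ C * (sin (θ / 2) ^ 2) ^ 2 := by
  obtain ⟨C, hC, h⟩ := exists_abs_sin_nat_mul_sub_le n
  refine ⟨2 * C + 2 * n * (1 + |2 / 3 * (1 - (n : ℝ) ^ 2)|), by positivity, fun θ hθ => ?_⟩
  have hcos : 0 ≤ cos (θ / 2) :=
    cos_nonneg_of_mem_Icc ⟨by linarith [hθ.1, pi_pos], by linarith [hθ.2]⟩
  have hsin : 0 < sin (θ / 2) :=
    sin_pos_of_pos_of_lt_pi (by linarith [hθ.1]) (by linarith [hθ.2, pi_pos])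
  have hsqrt : cos (θ / 2) = √(1 - sin (θ / 2) ^ 2) := by
    rw [← cos_sq', sqrt_sq hcos]
  have hsinsq : sin θ ^ 2 = 4 * sin (θ / 2) ^ 2 * (1 - sin (θ / 2) ^ 2) := by
    have : sin θ = 2 * sin (θ / 2) * cos (θ / 2) := by
      rw [← sin_two_mul]
      congr 1
      ring
    rw [this, mul_pow, cos_sq']
    ring
  have hy1 : sin (θ / 2) ^ 2 ≤ 1 := sin_sq_le_one _
  have hy0 : 0 < sin (θ / 2) ^ 2 := by positivity
  specialize h θ
  rw [one_sub_cos_eq, hsqrt]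
  generalize sin (θ / 2) ^ 2 = y at *
  have hr0 := sqrt_nonneg (1 - y)
  have hr1 : √(1 - y) ≤ 1 := sqrt_le_one.2 (by linarith)
  have hd := abs_sqrt_one_sub_sub_inv_le hy0.le hy1
  have hrsq : √(1 - y) ^ 2 = 1 - y := sq_sqrt (by linarith)
  set K : ℝ := 2 / 3 * (1 - (n : ℝ) ^ 2)
  have hsplit : sin θ * sin (n * θ) / (2 * y) -
      2 * n * ((1 + K * y) * (√(1 - y) / √(1 + y))) =
      sin θ * (sin (n * θ) - sin θ * (n * (1 + K * y))) / (2 * y) +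
        2 * n * (1 + K * y) * √(1 - y) * (√(1 - y) - 1 / √(1 + y)) := by
    have h1 : sin θ * (sin (n * θ) - sin θ * (n * (1 + K * y))) / (2 * y) =
        sin θ * sin (n * θ) / (2 * y) - 2 * n * (1 + K * y) * (1 - y) := by
      have : sin θ * (sin (n * θ) - sin θ * (n * (1 + K * y))) =
          sin θ * sin (n * θ) - (2 * n * (1 + K * y) * (1 - y)) * (2 * y) := by
        linear_combination (-(n * (1 + K * y))) * hsinsq
      rw [this, sub_div, mul_div_cancel_right₀ _ (by positivity)]
    rw [h1]
    linear_combination (-(2 * n * (1 + K * y))) * hrsq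
  rw [hsplit]
  refine (abs_add_le _ _).trans ?_
  have hA : |sin θ * (sin (n * θ) - sin θ * (n * (1 + K * y))) / (2 * y)| ≤ 2 * C * y ^ 2 := by
    rw [abs_div, abs_mul, abs_of_pos (show 0 < 2 * y by positivity), div_le_iff₀ (by positivity)]
    calc _ ≤ |sin θ| * (C * y ^ 2 * |sin θ|) := by gcongr
      _ = C * y ^ 2 * sin θ ^ 2 := by rw [← sq_abs (sin θ)]; ring
      _ = C * y ^ 2 * (4 * y * (1 - y)) := by rw [hsinsq]
      _ ≤ C * y ^ 2 * (4 * y * 1) := by gcongr; linarith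
      _ = _ := by ring
  have hB : |2 * n * (1 + K * y) * √(1 - y) * (√(1 - y) - 1 / √(1 + y))| ≤
      2 * n * (1 + |K|) * y ^ 2 := by
    have hK : |1 + K * y| ≤ 1 + |K| := by
      refine (abs_add_le _ _).trans ?_
      rw [abs_one, abs_mul, abs_of_pos hy0]
      gcongr
      exact mul_le_of_le_one_right (abs_nonneg _) hy1
    rw [abs_mul, abs_mul, abs_mul, abs_of_nonneg hr0,
      abs_of_nonneg (show (0 : ℝ) ≤ 2 * n by positivity)]
    calc _ ≤ 2 * n * (1 + |K|) * 1 * y ^ 2 := by gcongr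
      _ = _ := by ring
  linarith

theorem hasDerivAt_hitFactor (θ : ℝ) :
    HasDerivAt hitFactor (-(cos (θ / 2) / √(1 + sin (θ / 2) ^ 2)) * hitFactor θ) θ := by
  have hpos : 0 < 1 + sin (θ / 2) ^ 2 := by positivity
  have hs : HasDerivAt (fun θ => sin (θ / 2)) (cos (θ / 2) * (1 / 2)) θ :=
    ((hasDerivAt_id θ).div_const 2).sin
  have h := ((((hs.pow 2).const_add 1).sqrt hpos.ne').sub hs).pow 2
  refine h.congr_deriv ?_
  have hne : √(1 + sin (θ / 2) ^ 2) ≠ 0 := (sqrt_pos.2 hpos).ne'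
  simp only [hitFactor, Pi.pow_apply, Pi.sub_apply]
  field_simp
  push_cast
  ring

theorem integral_comparison (K : ℝ) (m : ℕ) :
    ∫ θ in (0 : ℝ)..π, (1 + K * sin (θ / 2) ^ 2) * (cos (θ / 2) / √(1 + sin (θ / 2) ^ 2)) *
        hitFactor θ ^ (m + 2) =
      (1 / (m + 2) + K / 4 * (1 / (m + 3) + 1 / (m + 1) - 2 / (m + 2))) -
      (hitFactor π ^ (m + 2) / (m + 2) + K / 4 * (hitFactor π ^ (m + 3) / (m + 3) +
        hitFactor π ^ (m + 1) / (m + 1) - 2 * hitFactor π ^ (m + 2) / (m + 2))) := by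
  have hderiv : ∀ θ ∈ Set.uIcc 0 π, HasDerivAt (fun θ => -(hitFactor θ ^ (m + 2) / (m + 2) +
      K / 4 * (hitFactor θ ^ (m + 3) / (m + 3) +
        hitFactor θ ^ (m + 1) / (m + 1) - 2 * hitFactor θ ^ (m + 2) / (m + 2))))
      ((1 + K * sin (θ / 2) ^ 2) * (cos (θ / 2) / √(1 + sin (θ / 2) ^ 2)) *
        hitFactor θ ^ (m + 2)) θ := fun θ _ => by
    have h := hasDerivAt_hitFactor θ
    refine (((h.pow (m + 2)).div_const (m + 2 : ℝ)).add
      (((((h.pow (m + 3)).div_const (m + 3 : ℝ)).add ((h.pow (m + 1)).div_const (m + 1 : ℝ))).sub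
        (((h.pow (m + 2)).const_mul 2).div_const (m + 2 : ℝ))).const_mul (K / 4))).neg.congr_deriv ?_
    have hr := hitFactor_sq_add_one θ
    have h1 : (m + 1 : ℝ) ≠ 0 := by positivity
    have h2 : (m + 2 : ℝ) ≠ 0 := by positivity
    have h3 : (m + 3 : ℝ) ≠ 0 := by positivity
    generalize cos (θ / 2) / √(1 + sin (θ / 2) ^ 2) = c
    simp only [show m + 2 - 1 = m + 1 from rfl, show m + 3 - 1 = m + 2 from rfl,
      Nat.add_sub_cancel]
    push_cast
    have e2 : ∀ z : ℝ, (m + 2 : ℝ) * z / (m + 2) = z := fun z => mul_div_cancel_left₀ z h2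
    have e1 : ∀ z : ℝ, (m + 1 : ℝ) * z / (m + 1) = z := fun z => mul_div_cancel_left₀ z h1
    have e3 : ∀ z : ℝ, (m + 3 : ℝ) * z / (m + 3) = z := fun z => mul_div_cancel_left₀ z h3
    simp only [mul_assoc, mul_div_assoc (2 : ℝ), e1, e2, e3]
    linear_combination (K / 4 * hitFactor θ ^ (m + 1) * c) * hr
  rw [intervalIntegral.integral_eq_sub_of_hasDerivAt hderiv]
  · have h0 : hitFactor 0 = 1 := by simp [hitFactor]
    simp only [h0, one_pow, mul_one]
    ring
  · have hc := continuous_hitFactor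
    apply Continuous.intervalIntegrable
    have : ∀ θ : ℝ, √(1 + sin (θ / 2) ^ 2) ≠ 0 := fun θ => (sqrt_pos.2 (by positivity)).ne'
    fun_prop (disch := assumption)

theorem integral_sin_pow_four_mul_hitFactor_pow_le {a : ℕ} (ha : 1 ≤ a) :
    ∫ θ in Set.Ioc 0 π, (sin (θ / 2) ^ 2) ^ 2 * hitFactor θ ^ a ≤ 24 * π ^ 5 / a ^ 5 := by
  have ha' : (0 : ℝ) < a := by exact_mod_cast ha
  have hr : 0 < a / π := by positivity
  have hG : ∫ θ in Set.Ioi (0 : ℝ), θ ^ 4 * exp (-(a / π * θ)) = 24 * π ^ 5 / a ^ 5 := by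
    have h := integral_rpow_mul_exp_neg_mul_Ioi (a := 5) (by norm_num) hr
    have h5 : Gamma 5 = 24 := by
      have := Gamma_nat_eq_factorial 4
      rw [show ((4 : ℕ) : ℝ) + 1 = 5 by norm_num] at this
      rw [this]
      norm_num [Nat.factorial]
    rw [h5, show (5 : ℝ) - 1 = (4 : ℕ) by norm_num, show (5 : ℝ) = (5 : ℕ) by norm_num,
      rpow_natCast] at h
    simp only [rpow_natCast] at h
    rw [h]
    field_simp
  have hint : IntegrableOn (fun θ => θ ^ 4 * exp (-(a / π * θ))) (Set.Ioi 0) :=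
    Integrable.of_integral_ne_zero (by rw [hG]; positivity)
  calc _ ≤ ∫ θ in Set.Ioc 0 π, θ ^ 4 * exp (-(a / π * θ)) := by
        have hc := continuous_hitFactor
        refine setIntegral_mono_on ?_ (hint.mono_set Set.Ioc_subset_Ioi_self) measurableSet_Ioc
          fun θ hθ => ?_
        · exact (Continuous.integrableOn_Icc (by fun_prop)).mono_set Set.Ioc_subset_Icc_self
        · have hs0 : 0 ≤ sin (θ / 2) :=
            sin_nonneg_of_nonneg_of_le_pi (by linarith [hθ.1]) (by linarith [hθ.2, pi_pos])
          have hs : sin (θ / 2) ≤ θ := (sin_le (by linarith [hθ.1])).trans (by linarith [hθ.1])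
          rw [← pow_mul]
          have hexp : exp (-(a / π * θ)) = exp (-(θ / π)) ^ a := by
            rw [← exp_nat_mul]
            congr 1
            ring
          rw [hexp]
          have := hitFactor_le_exp hθ.1.le hθ.2
          have := (hitFactor_pos θ).le
          gcongr
    _ ≤ ∫ θ in Set.Ioi (0 : ℝ), θ ^ 4 * exp (-(a / π * θ)) := by
        refine setIntegral_mono_set hint ?_ Set.Ioc_subset_Ioi_self.eventuallyLE
        filter_upwards [ae_restrict_mem measurableSet_Ioi] with θ hθ
        simp only [Pi.zero_apply]
        positivity
    _ = _ := hG

theorem hitFactor_pi_pow_le (m : ℕ) :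
    hitFactor π ^ (m + 1) ≤ 3840 / ((m : ℝ) + 2) ^ 5 := by
  have h1 : hitFactor π ≤ exp (-1) := by
    have := hitFactor_le_exp pi_pos.le le_rfl
    rwa [div_self pi_ne_zero] at this
  have h2 := pow_div_factorial_le_exp (x := (m : ℝ) + 1) (by positivity) 5
  have h3 : ((m : ℝ) + 2) ^ 5 / 32 ≤ (m + 1) ^ 5 := by
    have : ((m + 2) / 2 : ℝ) ^ 5 ≤ (m + 1) ^ 5 := by
      gcongr
      linarith [m.cast_nonneg (α := ℝ)]
    calc _ = ((m + 2) / 2 : ℝ) ^ 5 := by ring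
      _ ≤ _ := this
  calc hitFactor π ^ (m + 1) ≤ exp (-1) ^ (m + 1) := by
        have := (hitFactor_pos π).le
        gcongr
    _ = (exp (m + 1))⁻¹ := by
        rw [← exp_nat_mul, ← exp_neg]
        push_cast
        ring_nf
    _ ≤ ((m + 2 : ℝ) ^ 5 / 3840)⁻¹ := by
        refine inv_anti₀ (by positivity) (le_trans ?_ h2)
        norm_num [Nat.factorial]
        linarith
    _ = _ := inv_div _ _

theorem abs_boundary_term_le (K : ℝ) (m : ℕ) {r : ℝ} (h0 : 0 ≤ r) (h1 : r ≤ 1) :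
    |r ^ (m + 2) / (m + 2) + K / 4 * (r ^ (m + 3) / (m + 3) + r ^ (m + 1) / (m + 1) -
      2 * r ^ (m + 2) / (m + 2))| ≤ (1 + |K|) * r ^ (m + 1) := by
  have hp := pow_nonneg h0 (m + 1)
  have hb : ∀ k : ℕ, m + 1 ≤ k → 0 ≤ r ^ k / k ∧ r ^ k / k ≤ r ^ (m + 1) := fun k hk => by
    refine ⟨by positivity, (div_le_self (by positivity) ?_).trans (pow_le_pow_of_le_one h0 h1 hk)⟩
    exact_mod_cast (by omega : 1 ≤ k)
  have b1 := hb (m + 1) le_rfl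
  have b2 := hb (m + 2) (by omega)
  have b3 := hb (m + 3) (by omega)
  push_cast at b1 b2 b3
  rw [mul_div_assoc (2 : ℝ)]
  generalize r ^ (m + 2) / ((m : ℝ) + 2) = x at *
  generalize r ^ (m + 3) / ((m : ℝ) + 3) = z at *
  generalize r ^ (m + 1) / ((m : ℝ) + 1) = w at *
  refine (abs_add_le _ _).trans ?_
  rw [abs_mul, abs_div, abs_of_nonneg b2.1, abs_of_pos (show (0 : ℝ) < 4 by norm_num)]
  have : |z + w - 2 * x| ≤ 4 * r ^ (m + 1) := abs_le.2 ⟨by linarith, by linarith⟩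
  calc _ ≤ r ^ (m + 1) + |K| / 4 * (4 * r ^ (m + 1)) := by
        gcongr
        exact b2.2
    _ = _ := by ring

theorem exists_abs_Pfirst_sub_le (b : ℕ) : ∃ C : ℝ, ∀ m : ℕ,
    |Pfirst (m + 2) b - (1 / (π * (m + 2))) *
      (2 * (b : ℝ) + (2 / 3) * (b : ℝ) * (1 - (b : ℝ) ^ 2) / ((m : ℝ) + 2) ^ 2)| ≤
      C / ((m : ℝ) + 2) ^ 5 := by
  obtain ⟨C, hC, h⟩ := exists_abs_sin_mul_sin_div_sub_le b
  obtain ⟨K, hK⟩ : ∃ K : ℝ, K = 2 / 3 * (1 - (b : ℝ) ^ 2) := ⟨_, rfl⟩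
  rw [← hK] at h
  refine ⟨π⁻¹ * (C * (24 * π ^ 5) + 2 * b * ((1 + |K|) * 3840) + 2 * b * |K|), fun m => ?_⟩
  have hcont := continuous_hitFactor
  have hP := pi_mul_Pfirst (a := m + 2) (b := b) (by omega)
  have hI := integral_comparison K m
  rw [intervalIntegral.integral_of_le pi_pos.le] at hI
  have hint1 : IntegrableOn (fun θ => sin θ * sin (b * θ) / (1 - cos θ) * hitFactor θ ^ (m + 2))
      (Set.Ioc 0 π) := by
    have hb := integrable_sin_mul_sin_div b le_rfl
    rw [add_zero] at hb
    refine hb.mul_bdd (c := 1) (Continuous.aestronglyMeasurable (by fun_prop)) ?_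
    filter_upwards [ae_restrict_mem measurableSet_Ioc] with θ hθ
    have hpos := (hitFactor_pos θ).le
    rw [norm_pow, Real.norm_eq_abs, abs_of_nonneg hpos]
    refine pow_le_one₀ hpos ((hitFactor_le_exp hθ.1.le hθ.2).trans (exp_le_one_iff.2 ?_))
    exact neg_nonpos.2 (div_nonneg hθ.1.le pi_pos.le)
  have hint2 : IntegrableOn (fun θ => (1 + K * sin (θ / 2) ^ 2) *
      (cos (θ / 2) / √(1 + sin (θ / 2) ^ 2)) * hitFactor θ ^ (m + 2)) (Set.Ioc 0 π) := by
    have : ∀ θ : ℝ, √(1 + sin (θ / 2) ^ 2) ≠ 0 := fun θ => (sqrt_pos.2 (by positivity)).ne'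
    exact (Continuous.integrableOn_Icc (by fun_prop (disch := assumption))).mono_set
      Set.Ioc_subset_Icc_self
  have herr : |π * Pfirst (m + 2) b - 2 * b * ∫ θ in Set.Ioc 0 π, (1 + K * sin (θ / 2) ^ 2) *
      (cos (θ / 2) / √(1 + sin (θ / 2) ^ 2)) * hitFactor θ ^ (m + 2)| ≤
      C * (24 * π ^ 5 / ((m : ℝ) + 2) ^ 5) := by
    rw [hP, ← integral_const_mul, ← integral_sub hint1 (hint2.const_mul _)]
    calc _ ≤ ∫ θ in Set.Ioc 0 π, C * ((sin (θ / 2) ^ 2) ^ 2 * hitFactor θ ^ (m + 2)) := by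
          rw [← Real.norm_eq_abs]
          refine norm_integral_le_of_norm_le ?_ ?_
          · exact (Continuous.integrableOn_Icc (by fun_prop)).mono_set Set.Ioc_subset_Icc_self
          · filter_upwards [ae_restrict_mem measurableSet_Ioc] with θ hθ
            have hpos := pow_nonneg (hitFactor_pos θ).le (m + 2)
            rw [← mul_assoc (2 * (b : ℝ)), ← sub_mul, norm_mul, Real.norm_eq_abs,
              Real.norm_eq_abs, abs_of_nonneg hpos, ← mul_assoc C]
            exact mul_le_mul_of_nonneg_right (h θ hθ) hpos
      _ ≤ _ := by
          rw [integral_const_mul]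
          have := integral_sin_pow_four_mul_hitFactor_pow_le (a := m + 2) (by omega)
          push_cast at this
          gcongr
  rw [hI] at herr
  have hbd := (abs_boundary_term_le K m (hitFactor_pos π).le
    ((hitFactor_le_exp pi_pos.le le_rfl).trans (exp_le_one_iff.2 (by simp [pi_ne_zero])))).trans
    (mul_le_mul_of_nonneg_left (hitFactor_pi_pow_le m) (by positivity))
  generalize hitFactor π ^ (m + 2) / ((m : ℝ) + 2) + K / 4 * (hitFactor π ^ (m + 3) / (m + 3) +
        hitFactor π ^ (m + 1) / (m + 1) - 2 * hitFactor π ^ (m + 2) / (m + 2)) = B at *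
  have hmain : |K / 4 * (1 / (m + 3) + 1 / (m + 1) - 2 / ((m : ℝ) + 2)) -
      K / 2 / ((m : ℝ) + 2) ^ 3| ≤ |K| / ((m : ℝ) + 2) ^ 5 := by
    have : K / 4 * (1 / (m + 3) + 1 / (m + 1) - 2 / ((m : ℝ) + 2)) - K / 2 / ((m : ℝ) + 2) ^ 3 =
        K * (1 / (2 * ((m : ℝ) + 2) ^ 3 * ((m + 1) * (m + 3)))) := by
      field_simp
      ring
    rw [this, abs_mul, abs_of_nonneg (a := 1 / _) (by positivity), div_eq_mul_one_div |K|]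
    gcongr
    have hm := m.cast_nonneg (α := ℝ)
    have hle : ((m : ℝ) + 2) ^ 2 ≤ 2 * ((m + 1) * (m + 3)) := by nlinarith
    have hmul := mul_le_mul_of_nonneg_left hle (by positivity : (0 : ℝ) ≤ (m + 2) ^ 3)
    linarith
  set T : ℝ := K / 4 * (1 / (m + 3) + 1 / (m + 1) - 2 / ((m : ℝ) + 2))
  have hsplit : Pfirst (m + 2) b - (1 / (π * (m + 2))) *
      (2 * (b : ℝ) + (2 / 3) * (b : ℝ) * (1 - (b : ℝ) ^ 2) / ((m : ℝ) + 2) ^ 2) =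
      π⁻¹ * ((π * Pfirst (m + 2) b - 2 * b * (1 / (m + 2) + T - B)) - 2 * b * B +
        2 * b * (T - K / 2 / ((m : ℝ) + 2) ^ 3)) := by
    rw [hK]
    field_simp
    ring
  rw [hsplit, abs_mul, abs_of_pos (inv_pos.2 pi_pos), mul_div_assoc]
  refine mul_le_mul_of_nonneg_left ?_ (inv_pos.2 pi_pos).le
  refine (abs_add_le _ _).trans ((add_le_add_left (abs_sub _ _) _).trans ?_)
  have hb2 : (0 : ℝ) ≤ 2 * b := by positivity
  rw [abs_mul _ B, abs_mul _ (T - _), abs_of_nonneg hb2]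
  calc _ ≤ C * (24 * π ^ 5 / ((m : ℝ) + 2) ^ 5) +
        2 * b * ((1 + |K|) * (3840 / ((m : ℝ) + 2) ^ 5)) + 2 * b * (|K| / ((m : ℝ) + 2) ^ 5) := by
        gcongr
    _ = _ := by ring

theorem Pfirst_asymptotic_second_order (b : ℕ) (hb : 1 ≤ b) :
    (fun a : ℕ => Pfirst a b -
        (1 / (Real.pi * a)) * (2 * (b : ℝ) + (2 / 3) * (b : ℝ) * (1 - (b : ℝ) ^ 2) / (a : ℝ) ^ 2))
      =O[atTop] fun a : ℕ => ((a : ℝ)) ^ (-5 : ℤ) := by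
  obtain ⟨C, hC⟩ := exists_abs_Pfirst_sub_le b
  refine IsBigO.of_bound C ?_
  filter_upwards [eventually_ge_atTop 2] with a ha
  obtain ⟨m, rfl⟩ := Nat.exists_eq_add_of_le' ha
  have h := hC m
  rw [norm_zpow, Real.norm_eq_abs, Real.norm_eq_abs, Nat.abs_cast, zpow_neg,
    ← div_eq_mul_inv, show (5 : ℤ) = (5 : ℕ) by rfl, zpow_natCast]
  push_cast
  exact h
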